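/- Let β ∈ ℝ and let a, b be real constants. Set δ = (3/8) β a² and g₀(ρ) = a cos φ(ρ) with φ(ρ) = ρ + δ ln ρ + b. If δ ≥ 0 is sufficiently small, then the ordinary differential equation g''(ρ) + (1 + (β/ρ) g(ρ)² + 1/(4ρ²)) g(ρ) = 0 has a solution g on [1,∞) satisfying |g'(ρ) − g₀'(ρ)| + |g(ρ) − g₀(ρ)| ≤ C |a| / ρ for all ρ ≥ 1, for some constant C. -/

import Mathlib

open Real

section

open Set MeasureTheory

/-- The solution of `u'' + u = f` which vanishes at infinity, written with base point `c`. -/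
noncomputable def decaySol (c : ℝ) (f : ℝ → ℝ) (x : ℝ) : ℝ :=
  cos x * ((∫ s in Ioi c, sin s * f s) - ∫ s in c..x, sin s * f s)
    - sin x * ((∫ s in Ioi c, cos s * f s) - ∫ s in c..x, cos s * f s)

/-- The derivative of `decaySol c f`. -/
noncomputable def decaySolDeriv (c : ℝ) (f : ℝ → ℝ) (x : ℝ) : ℝ :=
  -sin x * ((∫ s in Ioi c, sin s * f s) - ∫ s in c..x, sin s * f s)
    - cos x * ((∫ s in Ioi c, cos s * f s) - ∫ s in c..x, cos s * f s)

lemma hasDerivAt_decaySol (c : ℝ) {f : ℝ → ℝ} (hf : Continuous f) (x : ℝ) :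
    HasDerivAt (decaySol c f) (decaySolDeriv c f x) x := by
  have h1 := (show Continuous fun s => sin s * f s by fun_prop).integral_hasStrictDerivAt c x
  have h2 := (show Continuous fun s => cos s * f s by fun_prop).integral_hasStrictDerivAt c x
  have h := ((hasDerivAt_cos x).mul (h1.hasDerivAt.const_sub (∫ s in Ioi c, sin s * f s))).sub
    ((hasDerivAt_sin x).mul (h2.hasDerivAt.const_sub (∫ s in Ioi c, cos s * f s)))
  refine h.congr_deriv ?_
  simp only [decaySolDeriv]
  ring

lemma hasDerivAt_decaySolDeriv (c : ℝ) {f : ℝ → ℝ} (hf : Continuous f) (x : ℝ) :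
    HasDerivAt (decaySolDeriv c f) (f x - decaySol c f x) x := by
  have h1 := (show Continuous fun s => sin s * f s by fun_prop).integral_hasStrictDerivAt c x
  have h2 := (show Continuous fun s => cos s * f s by fun_prop).integral_hasStrictDerivAt c x
  have h := ((hasDerivAt_sin x).neg.mul
    (h1.hasDerivAt.const_sub (∫ s in Ioi c, sin s * f s))).sub
    ((hasDerivAt_cos x).mul (h2.hasDerivAt.const_sub (∫ s in Ioi c, cos s * f s)))
  refine h.congr_deriv ?_
  simp only [decaySol, Pi.neg_apply]
  linear_combination f x * (sin_sq_add_cos_sq x)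

lemma integrableOn_mul_of_abs_le_one {c : ℝ} {f k : ℝ → ℝ} (hk : Continuous k)
    (hk1 : ∀ s, |k s| ≤ 1) (hf : IntegrableOn f (Ioi c)) :
    IntegrableOn (fun s => k s * f s) (Ioi c) :=
  Integrable.bdd_mul (c := 1) hf hk.aestronglyMeasurable
    (Filter.Eventually.of_forall fun s => by simpa using hk1 s)

lemma integral_Ioi_sub_intervalIntegral {c x : ℝ} {f : ℝ → ℝ} (hx : c ≤ x)
    (hf : IntegrableOn f (Ioi c)) :
    (∫ s in Ioi c, f s) - ∫ s in c..x, f s = ∫ s in Ioi x, f s := by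
  have := intervalIntegral.integral_Ioi_sub_Ioi hf hx
  linarith

lemma decaySol_eq {c x : ℝ} {f : ℝ → ℝ} (hx : c ≤ x) (hf : IntegrableOn f (Ioi c)) :
    decaySol c f x = ∫ s in Ioi x, sin (s - x) * f s := by
  have hs := integrableOn_mul_of_abs_le_one continuous_sin abs_sin_le_one hf
  have hc := integrableOn_mul_of_abs_le_one continuous_cos abs_cos_le_one hf
  rw [decaySol, integral_Ioi_sub_intervalIntegral hx hs, integral_Ioi_sub_intervalIntegral hx hc,
    ← integral_const_mul, ← integral_const_mul, ← integral_sub]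
  · congr 1 with s
    rw [sin_sub]
    ring
  · exact (hs.mono_set (Ioi_subset_Ioi hx)).const_mul _
  · exact (hc.mono_set (Ioi_subset_Ioi hx)).const_mul _

lemma decaySolDeriv_eq {c x : ℝ} {f : ℝ → ℝ} (hx : c ≤ x) (hf : IntegrableOn f (Ioi c)) :
    decaySolDeriv c f x = ∫ s in Ioi x, -cos (s - x) * f s := by
  have hs := integrableOn_mul_of_abs_le_one continuous_sin abs_sin_le_one hf
  have hc := integrableOn_mul_of_abs_le_one continuous_cos abs_cos_le_one hf
  rw [decaySolDeriv, integral_Ioi_sub_intervalIntegral hx hs,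
    integral_Ioi_sub_intervalIntegral hx hc,
    ← integral_const_mul, ← integral_const_mul, ← integral_sub]
  · congr 1 with s
    rw [cos_sub]
    ring
  · exact (hs.mono_set (Ioi_subset_Ioi hx)).const_mul _
  · exact (hc.mono_set (Ioi_subset_Ioi hx)).const_mul _

lemma integrableOn_Ioi_const_div_sq {x : ℝ} (hx : 0 < x) (B : ℝ) :
    IntegrableOn (fun s : ℝ => B / s ^ 2) (Ioi x) := by
  have h := (integrableOn_Ioi_rpow_of_lt (a := -2) (by norm_num) hx).const_mul B
  refine IntegrableOn.congr_fun h (fun s hs => ?_) measurableSet_Ioi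
  have hs0 : 0 < s := hx.trans hs
  simp only [rpow_neg hs0.le, div_eq_mul_inv]
  norm_cast

lemma integral_Ioi_const_div_sq {x : ℝ} (hx : 0 < x) (B : ℝ) :
    ∫ s in Ioi x, B / s ^ 2 = B / x := by
  have h := integral_Ioi_rpow_of_lt (a := -2) (by norm_num) hx
  have h2 : ∫ s in Ioi x, B / s ^ 2 = ∫ s in Ioi x, B * s ^ (-2 : ℝ) := by
    refine setIntegral_congr_fun measurableSet_Ioi (fun s hs => ?_)
    have hs0 : 0 < s := hx.trans hs
    simp only [rpow_neg hs0.le, div_eq_mul_inv]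
    norm_cast
  rw [h2, integral_const_mul, h]
  norm_num [rpow_neg hx.le, div_eq_mul_inv]

lemma abs_integral_Ioi_mul_le {x B : ℝ} {f k : ℝ → ℝ} (hx : 0 < x) (hk1 : ∀ s, |k s| ≤ 1)
    (hB : ∀ s, x ≤ s → |f s| ≤ B / s ^ 2) :
    |∫ s in Ioi x, k s * f s| ≤ B / x := by
  rw [← integral_Ioi_const_div_sq hx, ← norm_eq_abs]
  refine norm_integral_le_of_norm_le (integrableOn_Ioi_const_div_sq hx B) ?_
  refine (ae_restrict_iff' measurableSet_Ioi).2 (Filter.Eventually.of_forall fun s hs => ?_)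
  rw [norm_eq_abs, abs_mul]
  have := hB s hs.le
  nlinarith [hk1 s, abs_nonneg (f s)]

lemma integrableOn_Ioi_of_abs_le_div_sq {c B : ℝ} {f : ℝ → ℝ} (hc : 0 < c) (hf : Continuous f)
    (hB : ∀ s, c ≤ s → |f s| ≤ B / s ^ 2) : IntegrableOn f (Ioi c) := by
  refine (integrableOn_Ioi_const_div_sq hc B).mono' hf.aestronglyMeasurable ?_
  exact (ae_restrict_iff' measurableSet_Ioi).2 (Filter.Eventually.of_forall fun s hs => hB s hs.le)

lemma abs_decaySol_le {c x B : ℝ} {f : ℝ → ℝ} (hc : 0 < c) (hx : c ≤ x) (hf : Continuous f)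
    (hB : ∀ s, c ≤ s → |f s| ≤ B / s ^ 2) : |decaySol c f x| ≤ B / x := by
  rw [decaySol_eq hx (integrableOn_Ioi_of_abs_le_div_sq hc hf hB)]
  exact abs_integral_Ioi_mul_le (hc.trans_le hx) (fun s => abs_sin_le_one _)
    fun s hs => hB s (hx.trans hs)

lemma abs_decaySolDeriv_le {c x B : ℝ} {f : ℝ → ℝ} (hc : 0 < c) (hx : c ≤ x)
    (hf : Continuous f) (hB : ∀ s, c ≤ s → |f s| ≤ B / s ^ 2) :
    |decaySolDeriv c f x| ≤ B / x := by
  rw [decaySolDeriv_eq hx (integrableOn_Ioi_of_abs_le_div_sq hc hf hB)]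
  exact abs_integral_Ioi_mul_le (hc.trans_le hx)
    (fun s => by rw [abs_neg]; exact abs_cos_le_one _) fun s hs => hB s (hx.trans hs)

lemma decaySol_sub {c x : ℝ} {f g : ℝ → ℝ} (hx : c ≤ x) (hf : IntegrableOn f (Ioi c))
    (hg : IntegrableOn g (Ioi c)) :
    decaySol c (fun s => f s - g s) x = decaySol c f x - decaySol c g x := by
  rw [decaySol_eq hx hf, decaySol_eq hx hg, decaySol_eq (f := fun s => f s - g s) hx (hf.sub hg),
    ← integral_sub]
  · congr 1 with s
    ring
  · exact integrableOn_mul_of_abs_le_one (by fun_prop) (fun s => abs_sin_le_one _)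
      (hf.mono_set (Ioi_subset_Ioi hx))
  · exact integrableOn_mul_of_abs_le_one (by fun_prop) (fun s => abs_sin_le_one _)
      (hg.mono_set (Ioi_subset_Ioi hx))

/-- A perturbation `w'' + w = G(s, w)` of the harmonic oscillator, with `G(s, 0) = O(s⁻²)` and
`G(s, ·)` Lipschitz with constant `L / s`, `L < 1`, has a solution decaying like `1 / s`. -/
theorem exists_decaying_solution {c K L : ℝ} (hc : 0 < c) (hL0 : 0 ≤ L)
    (hL : L < 1) {G : ℝ → ℝ → ℝ}
    (hG : ContinuousOn (Function.uncurry G) (Ici c ×ˢ univ))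
    (hG0 : ∀ s, c ≤ s → |G s 0| ≤ K / s ^ 2)
    (hLip : ∀ s, c ≤ s → ∀ x y, |G s x - G s y| ≤ L / s * |x - y|) :
    ∃ w w' : ℝ → ℝ, ∀ s, c ≤ s → HasDerivAt w (w' s) s ∧
      (c < s → HasDerivAt w' (G s (w s) - w s) s) ∧
      |w s| ≤ K / (1 - L) / s ∧ |w' s| ≤ K / (1 - L) / s := by
  have hm : ∀ s, 0 < max s c := fun s => lt_max_of_lt_right hc
  let F : BoundedContinuousFunction ℝ ℝ → ℝ → ℝ := fun v s => G (max s c) (v s / max s c)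
  have hFc : ∀ v, Continuous (F v) := by
    intro v
    have hmap : Continuous fun s : ℝ => (max s c, v s / max s c) :=
      (by fun_prop : Continuous fun s : ℝ => max s c).prodMk
        (v.continuous.div (by fun_prop) fun s => (hm s).ne')
    exact hG.comp_continuous hmap fun s => ⟨le_max_right s c, mem_univ _⟩
  have hFsub : ∀ u v s, c ≤ s → |F u s - F v s| ≤ L * dist u v / s ^ 2 := by
    intro u v s hs
    have hs0 := hc.trans_le hs
    simp only [F, max_eq_left hs]
    refine (hLip s hs _ _).trans ?_
    rw [← sub_div, abs_div, abs_of_pos hs0, ← dist_eq]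
    have := u.dist_coe_le_dist (g := v) s
    calc L / s * (dist (u s) (v s) / s) = L * dist (u s) (v s) / s ^ 2 := by field_simp
      _ ≤ _ := by gcongr
  have hF : ∀ v s, c ≤ s → |F v s| ≤ (K + L * ‖v‖) / s ^ 2 := by
    intro v s hs
    have h1 := hFsub v 0 s hs
    have h2 := hG0 s hs
    have h3 : F 0 s = G s 0 := by simp [F, max_eq_left hs]
    rw [h3, dist_zero_right] at h1
    rw [add_div]
    calc |F v s| = |G s 0 + (F v s - G s 0)| := by ring_nf
      _ ≤ _ := (abs_add_le _ _).trans (add_le_add h2 h1)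
  have hFi : ∀ v, IntegrableOn (F v) (Ioi c) := fun v =>
    integrableOn_Ioi_of_abs_le_div_sq hc (hFc v) (hF v)
  have hbd : ∀ v x, |max x c * decaySol c (F v) (max x c)| ≤ K + L * ‖v‖ := by
    intro v x
    rw [abs_mul, abs_of_pos (hm x)]
    have := abs_decaySol_le hc (le_max_right x c) (hFc v) (hF v)
    rwa [le_div_iff₀' (hm x)] at this
  let Φ : BoundedContinuousFunction ℝ ℝ → BoundedContinuousFunction ℝ ℝ := fun v =>
    BoundedContinuousFunction.ofNormedAddCommGroup
      (fun x => max x c * decaySol c (F v) (max x c))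
      (((by fun_prop : Continuous fun x : ℝ => max x c)).mul
        ((continuous_iff_continuousAt.2 fun x =>
          (hasDerivAt_decaySol c (hFc v) x).continuousAt).comp (by fun_prop)))
      (K + L * ‖v‖) (hbd v)
  have hΦ : ContractingWith ⟨L, hL0⟩ Φ := by
    refine ⟨hL, LipschitzWith.of_dist_le_mul fun u v => ?_⟩
    refine (BoundedContinuousFunction.dist_le (by positivity)).2 fun x => ?_
    change |max x c * decaySol c (F u) (max x c) - max x c * decaySol c (F v) (max x c)|
      ≤ L * dist u v
    rw [← mul_sub, ← decaySol_sub (le_max_right x c) (hFi u) (hFi v), abs_mul,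
      abs_of_pos (hm x)]
    have := abs_decaySol_le hc (le_max_right x c) ((hFc u).sub (hFc v)) (hFsub u v)
    rwa [le_div_iff₀' (hm x)] at this
  obtain ⟨v, hv⟩ : ∃ v, Φ v = v := ⟨_, hΦ.fixedPoint_isFixedPt⟩
  have hvx : ∀ x, c ≤ x → v x = x * decaySol c (F v) x := by
    intro x hx
    conv_lhs => rw [← hv]
    change max x c * decaySol c (F v) (max x c) = _
    rw [max_eq_left hx]
  have hK0 : 0 ≤ K := by
    have := (abs_nonneg _).trans (hG0 c le_rfl)
    rwa [le_div_iff₀ (by positivity), zero_mul] at this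
  have hvn : K + L * ‖v‖ ≤ K / (1 - L) := by
    have : ‖v‖ ≤ K + L * ‖v‖ := by
      refine (BoundedContinuousFunction.norm_le (by positivity)).2 fun x => ?_
      conv_lhs => rw [← hv]
      exact hbd v x
    rw [le_div_iff₀ (by linarith)]
    nlinarith
  refine ⟨decaySol c (F v), decaySolDeriv c (F v), fun s hs => ?_⟩
  have hs0 := hc.trans_le hs
  refine ⟨hasDerivAt_decaySol c (hFc v) s, fun _ => ?_, ?_, ?_⟩
  · convert hasDerivAt_decaySolDeriv c (hFc v) s using 2
    simp only [F, max_eq_left hs, hvx s hs]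
    rw [mul_div_cancel_left₀ _ hs0.ne']
  · exact (abs_decaySol_le hc hs (hFc v) (hF v)).trans (by gcongr)
  · exact (abs_decaySolDeriv_le hc hs (hFc v) (hF v)).trans (by gcongr)

lemma abs_clamp_cube_sub_le {R : ℝ} (hR : 0 ≤ R) (x y : ℝ) :
    |max (-R) (min R x) ^ 3 - max (-R) (min R y) ^ 3| ≤ 3 * R ^ 2 * |x - y| := by
  have hb : ∀ z, |max (-R) (min R z)| ≤ R := fun z =>
    abs_le.2 ⟨le_max_left _ _, max_le (by linarith) (min_le_left _ _)⟩
  have hd : |max (-R) (min R x) - max (-R) (min R y)| ≤ |x - y| :=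
    by
      have h1 := abs_max_sub_max_le_max (-R) (min R x) (-R) (min R y)
      have h2 := abs_min_sub_min_le_max R x R y
      simp only [sub_self, abs_zero, sup_of_le_right, abs_nonneg] at h1 h2
      exact h1.trans h2
  have hp := hb x
  have hq := hb y
  generalize max (-R) (min R x) = p at *
  generalize max (-R) (min R y) = q at *
  have h1 : |p ^ 2 + p * q + q ^ 2| ≤ 3 * R ^ 2 := by
    rw [abs_le] at *
    constructor <;> nlinarith
  calc |p ^ 3 - q ^ 3| = |p ^ 2 + p * q + q ^ 2| * |p - q| := by rw [← abs_mul]; ring_nf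
    _ ≤ _ := by gcongr

/-- The phase `φ(s) = s + δ log s + b`. -/
noncomputable def phase (δ b s : ℝ) : ℝ := s + δ * log s + b

lemma hasDerivAt_phase (δ b : ℝ) {s : ℝ} (hs : 0 < s) :
    HasDerivAt (phase δ b) (1 + δ / s) s := by
  have h := ((hasDerivAt_id s).add ((hasDerivAt_log hs.ne').const_mul δ)).add_const b
  exact h

/-- The refined profile `cos φ + κ / (32 s) cos (3 φ)`, where `δ = 3 κ / 8`. -/
noncomputable def refinedProfile (κ b s : ℝ) : ℝ :=
  cos (phase (3 / 8 * κ) b s) + κ / 32 / s * cos (3 * phase (3 / 8 * κ) b s)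

/-- The derivative of `refinedProfile κ b`. -/
noncomputable def refinedProfileDeriv (κ b s : ℝ) : ℝ :=
  -sin (phase (3 / 8 * κ) b s) * (1 + 3 / 8 * κ / s)
    - κ / 32 / s ^ 2 * cos (3 * phase (3 / 8 * κ) b s)
    - 3 * (κ / 32) / s * sin (3 * phase (3 / 8 * κ) b s) * (1 + 3 / 8 * κ / s)

/-- `s²` times the residual of `refinedProfile κ b` in the differential equation. -/
noncomputable def profileResidual (κ b s : ℝ) : ℝ :=
  (1 / 4 - (3 / 8 * κ) ^ 2) * cos (phase (3 / 8 * κ) b s)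
    + 3 / 8 * κ * sin (phase (3 / 8 * κ) b s)
    + κ / 32 * ((9 / 4 * s⁻¹ - 9 * (2 * (3 / 8 * κ) + (3 / 8 * κ) ^ 2 * s⁻¹)
          + κ * (refinedProfile κ b s ^ 2
            + refinedProfile κ b s * cos (phase (3 / 8 * κ) b s)
            + cos (phase (3 / 8 * κ) b s) ^ 2)) * cos (3 * phase (3 / 8 * κ) b s)
        + (6 * (1 + 3 / 8 * κ * s⁻¹) + 3 * (3 / 8 * κ) * s⁻¹)
          * sin (3 * phase (3 / 8 * κ) b s))

lemma hasDerivAt_refinedProfile (κ b : ℝ) {s : ℝ} (hs : 0 < s) :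
    HasDerivAt (refinedProfile κ b) (refinedProfileDeriv κ b s) s := by
  have hp := hasDerivAt_phase (3 / 8 * κ) b hs
  have h := hp.cos.add (((hasDerivAt_inv hs.ne').const_mul (κ / 32)).mul (hp.const_mul 3).cos)
  refine h.congr_deriv ?_
  simp only [refinedProfileDeriv]
  field_simp
  ring

lemma hasDerivAt_refinedProfileDeriv (κ b : ℝ) {s : ℝ} (hs : 0 < s) :
    HasDerivAt (refinedProfileDeriv κ b)
      (profileResidual κ b s / s ^ 2 - (refinedProfile κ b s + κ / s * refinedProfile κ b s ^ 3
        + refinedProfile κ b s / (4 * s ^ 2))) s := by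
  have hp := hasDerivAt_phase (3 / 8 * κ) b hs
  have hi := hasDerivAt_inv hs.ne'
  have hq := (hi.const_mul (3 / 8 * κ)).const_add 1
  have h := ((hp.sin.neg.mul hq).sub
    (((hi.pow 2).const_mul (κ / 32)).mul (hp.const_mul 3).cos)).sub
    (((hi.const_mul (3 * (κ / 32))).mul (hp.const_mul 3).sin).mul hq)
  have he : ∀ x, refinedProfileDeriv κ b x = _ := fun x => by
    rw [refinedProfileDeriv, div_eq_mul_inv (3 / 8 * κ), div_eq_mul_inv (κ / 32), ← inv_pow,
      div_eq_mul_inv (3 * (κ / 32))]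
  refine (h.congr_of_eventuallyEq (Filter.Eventually.of_forall he)).congr_deriv ?_
  have h3 := cos_three_mul (phase (3 / 8 * κ) b s)
  simp only [profileResidual, refinedProfile, Pi.pow_apply, Pi.neg_apply, Pi.mul_apply,
    Nat.cast_ofNat]
  generalize cos (3 * phase (3 / 8 * κ) b s) = C3 at *
  generalize cos (phase (3 / 8 * κ) b s) = C at *
  generalize sin (3 * phase (3 / 8 * κ) b s) = S3 at *
  generalize sin (phase (3 / 8 * κ) b s) = S at *
  linear_combination (-(κ / 4 / s)) * h3

lemma abs_refinedProfile_sub_cos_le {κ s : ℝ} (hκ0 : 0 ≤ κ) (hκ : κ ≤ 1) (b : ℝ)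
    (hs : 1 / 2 ≤ s) :
    |refinedProfile κ b s - cos (phase (3 / 8 * κ) b s)| ≤ 1 / s := by
  have hs0 : 0 < s := by linarith
  rw [refinedProfile, add_sub_cancel_left, abs_mul, abs_of_nonneg (by positivity)]
  calc κ / 32 / s * |cos (3 * phase (3 / 8 * κ) b s)| ≤ 1 / s * 1 := by
        gcongr
        · linarith
        · exact abs_cos_le_one _
    _ = 1 / s := mul_one _

lemma abs_refinedProfileDeriv_add_sin_le {κ s : ℝ} (hκ0 : 0 ≤ κ) (hκ : κ ≤ 1) (b : ℝ)
    (hs : 1 / 2 ≤ s) :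
    |refinedProfileDeriv κ b s - -sin (phase (3 / 8 * κ) b s) * (1 + 3 / 8 * κ / s)|
      ≤ 1 / s := by
  have hs0 : 0 < s := by linarith
  have hi : s⁻¹ ≤ 2 := by rw [inv_le_comm₀ hs0 two_pos]; linarith
  have hi0 : 0 < s⁻¹ := by positivity
  have e : refinedProfileDeriv κ b s - -sin (phase (3 / 8 * κ) b s) * (1 + 3 / 8 * κ / s)
      = -(κ / 32 * (s⁻¹ * cos (3 * phase (3 / 8 * κ) b s)
        + 3 * (1 + 3 / 8 * κ * s⁻¹) * sin (3 * phase (3 / 8 * κ) b s))) / s := by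
    rw [refinedProfileDeriv]
    field_simp
    ring
  rw [e, abs_div, abs_neg, abs_of_pos hs0]
  gcongr
  have hA : |s⁻¹ * cos (3 * phase (3 / 8 * κ) b s)| ≤ 2 * 1 := by
    rw [abs_mul, abs_of_pos hi0]
    gcongr
    exact abs_cos_le_one _
  have hB : |3 * (1 + 3 / 8 * κ * s⁻¹) * sin (3 * phase (3 / 8 * κ) b s)|
      ≤ 3 * (1 + 3 / 8 * 1 * 2) * 1 := by
    rw [abs_mul, abs_of_nonneg (by positivity)]
    gcongr
    exact abs_sin_le_one _
  rw [abs_mul, abs_of_nonneg (by positivity : 0 ≤ κ / 32)]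
  calc κ / 32 * _ ≤ 1 / 32 * (2 * 1 + 3 * (1 + 3 / 8 * 1 * 2) * 1) := by
        gcongr
        exact (abs_add_le _ _).trans (add_le_add hA hB)
    _ ≤ 1 := by norm_num

lemma abs_refinedProfile_le {κ s : ℝ} (hκ0 : 0 ≤ κ) (hκ : κ ≤ 1) (b : ℝ) (hs : 1 / 2 ≤ s) :
    |refinedProfile κ b s| ≤ 3 := by
  have h := abs_le.1 (abs_refinedProfile_sub_cos_le hκ0 hκ b hs)
  have hc := abs_le.1 (abs_cos_le_one (phase (3 / 8 * κ) b s))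
  have hi : 1 / s ≤ 2 := by
    rw [div_le_iff₀ (by linarith)]
    linarith
  exact abs_le.2 ⟨by linarith, by linarith⟩

lemma abs_profileResidual_le {κ s : ℝ} (hκ0 : 0 ≤ κ) (hκ : κ ≤ 1) (b : ℝ) (hs : 1 / 2 ≤ s) :
    |profileResidual κ b s| ≤ 4 := by
  have hs0 : 0 < s := by linarith
  have hh := abs_refinedProfile_le hκ0 hκ b hs
  have hi : s⁻¹ ≤ 2 := by rw [inv_le_comm₀ hs0 two_pos]; linarith
  have hi0 : 0 < s⁻¹ := by positivity
  rw [profileResidual]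
  have hC := abs_cos_le_one (phase (3 / 8 * κ) b s)
  have hS := abs_sin_le_one (phase (3 / 8 * κ) b s)
  have hC3 := abs_cos_le_one (3 * phase (3 / 8 * κ) b s)
  have hS3 := abs_sin_le_one (3 * phase (3 / 8 * κ) b s)
  generalize cos (3 * phase (3 / 8 * κ) b s) = C3 at *
  generalize cos (phase (3 / 8 * κ) b s) = C at *
  generalize sin (3 * phase (3 / 8 * κ) b s) = S3 at *
  generalize sin (phase (3 / 8 * κ) b s) = S at *
  generalize refinedProfile κ b s = h at *
  generalize s⁻¹ = q at *
  have h1 : |(1 / 4 - (3 / 8 * κ) ^ 2) * C| ≤ 1 / 4 * 1 := by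
    rw [abs_mul]
    gcongr
    rw [abs_le]
    constructor <;> nlinarith
  have h2 : |3 / 8 * κ * S| ≤ 3 / 8 * 1 * 1 := by
    rw [abs_mul, abs_of_nonneg (by positivity)]
    gcongr
  have h3 : |h ^ 2 + h * C + C ^ 2| ≤ 13 := by
    rw [abs_le] at *
    constructor <;> nlinarith
  have h4 : |κ * (h ^ 2 + h * C + C ^ 2)| ≤ 1 * 13 := by
    rw [abs_mul, abs_of_nonneg hκ0]
    gcongr
  have h5 : 0 ≤ 9 * (2 * (3 / 8 * κ) + (3 / 8 * κ) ^ 2 * q) := by positivity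
  have h6 : 9 * (2 * (3 / 8 * κ) + (3 / 8 * κ) ^ 2 * q)
      ≤ 9 * (2 * (3 / 8 * 1) + (3 / 8 * 1) ^ 2 * 2) := by gcongr
  have h7 : |(9 / 4 * q - 9 * (2 * (3 / 8 * κ) + (3 / 8 * κ) ^ 2 * q)
      + κ * (h ^ 2 + h * C + C ^ 2)) * C3| ≤ 30 * 1 := by
    rw [abs_mul]
    gcongr
    rw [abs_le] at h4 ⊢
    constructor <;> linarith
  have h8 : |(6 * (1 + 3 / 8 * κ * q) + 3 * (3 / 8 * κ) * q) * S3|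
      ≤ (6 * (1 + 3 / 8 * 1 * 2) + 3 * (3 / 8 * 1) * 2) * 1 := by
    rw [abs_mul, abs_of_nonneg (by positivity)]
    gcongr
  refine (abs_add_le _ _).trans ?_
  have h9 := (abs_add_le _ _).trans (add_le_add h1 h2)
  have h10 := (abs_add_le _ _).trans (add_le_add h7 h8)
  rw [abs_mul, abs_of_nonneg (by positivity : 0 ≤ κ / 32)]
  have h11 := mul_le_mul (by linarith : κ / 32 ≤ 1 / 32) h10 (abs_nonneg _) (by norm_num)
  linarith

/-- The normalized equation has a solution asymptotic to `cos φ`. -/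
theorem exists_normalized_solution {κ : ℝ} (hκ0 : 0 ≤ κ) (hκ : κ ≤ 1 / 20000) (b : ℝ) :
    ∃ h h' : ℝ → ℝ, ∀ s, 1 / 2 < s → HasDerivAt h (h' s) s ∧
      HasDerivAt h' (-((1 + κ / s * h s ^ 2 + 1 / (4 * s ^ 2)) * h s)) s ∧
      |h s - cos (phase (3 / 8 * κ) b s)| ≤ 17 / s ∧
      |h' s - -sin (phase (3 / 8 * κ) b s) * (1 + 3 / 8 * κ / s)| ≤ 17 / s := by
  have hκ1 : κ ≤ 1 := by linarith
  let cl : ℝ → ℝ := fun x => max (-36) (min 36 x)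
  have hcl : ∀ x, |x| ≤ 36 → cl x = x := fun x hx => by
    rw [abs_le] at hx
    simp only [cl, min_eq_right hx.2, max_eq_right hx.1]
  let G : ℝ → ℝ → ℝ := fun s x => -(profileResidual κ b s / s ^ 2)
    - κ / s * (cl (refinedProfile κ b s + x) ^ 3 - refinedProfile κ b s ^ 3) - x / (4 * s ^ 2)
  have hG : ContinuousOn (Function.uncurry G) (Ici (1 / 2) ×ˢ univ) := by
    have hne : ∀ p ∈ Ici (1 / 2 : ℝ) ×ˢ (univ : Set ℝ), p.1 ≠ 0 := fun p hp =>
      ((by norm_num : (0 : ℝ) < 1 / 2).trans_le hp.1).ne'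
    have hph : ContinuousOn (fun p : ℝ × ℝ => phase (3 / 8 * κ) b p.1)
        (Ici (1 / 2) ×ˢ univ) := by
      unfold phase
      fun_prop (disch := assumption)
    have hr : ContinuousOn (fun p : ℝ × ℝ => refinedProfile κ b p.1)
        (Ici (1 / 2) ×ˢ univ) := by
      unfold refinedProfile
      fun_prop (disch := assumption)
    have he : ContinuousOn (fun p : ℝ × ℝ => profileResidual κ b p.1)
        (Ici (1 / 2) ×ˢ univ) := by
      unfold profileResidual
      fun_prop (disch := assumption)
    have hne2 : ∀ p ∈ Ici (1 / 2 : ℝ) ×ˢ (univ : Set ℝ), p.1 ^ 2 ≠ 0 := fun p hp =>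
      pow_ne_zero 2 (hne p hp)
    have hne4 : ∀ p ∈ Ici (1 / 2 : ℝ) ×ˢ (univ : Set ℝ), 4 * p.1 ^ 2 ≠ 0 := fun p hp =>
      mul_ne_zero four_ne_zero (hne2 p hp)
    simp only [Function.uncurry_def, G, cl]
    fun_prop (disch := assumption)
  have hG0 : ∀ s, 1 / 2 ≤ s → |G s 0| ≤ 4 / s ^ 2 := by
    intro s hs
    have hb := abs_refinedProfile_le hκ0 hκ1 b hs
    simp only [G, add_zero, hcl _ (hb.trans (by norm_num)), sub_self, mul_zero, sub_zero, zero_div,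
      abs_neg, abs_div, abs_pow, sq_abs]
    gcongr
    exact abs_profileResidual_le hκ0 hκ1 b hs
  have hLip : ∀ s, 1 / 2 ≤ s → ∀ x y, |G s x - G s y| ≤ 3 / 4 / s * |x - y| := by
    intro s hs x y
    have hs0 : 0 < s := by linarith
    have hi : s⁻¹ ≤ 2 := by rw [inv_le_comm₀ hs0 two_pos]; linarith
    have hd := abs_clamp_cube_sub_le (R := 36) (by norm_num) (refinedProfile κ b s + x)
      (refinedProfile κ b s + y)
    rw [add_sub_add_left_eq_sub] at hd
    have e : G s x - G s y = -(s⁻¹ * (κ * (cl (refinedProfile κ b s + x) ^ 3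
        - cl (refinedProfile κ b s + y) ^ 3) + s⁻¹ / 4 * (x - y))) := by
      simp only [G]
      field_simp
      ring
    rw [e, abs_neg, abs_mul, abs_of_pos (by positivity : 0 < s⁻¹)]
    calc _ ≤ s⁻¹ * (1 / 20000 * (3 * 36 ^ 2 * |x - y|) + 2 / 4 * |x - y|) := by
          gcongr
          refine (abs_add_le _ _).trans (add_le_add ?_ ?_)
          · rw [abs_mul, abs_of_nonneg hκ0]
            gcongr
          · rw [abs_mul, abs_of_pos (by positivity)]
            gcongr
      _ ≤ s⁻¹ * (3 / 4 * |x - y|) := by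
          gcongr
          linarith [abs_nonneg (x - y)]
      _ = _ := by ring
  obtain ⟨w, w', hw⟩ := exists_decaying_solution (by norm_num) (by norm_num) (by norm_num)
    hG hG0 hLip
  refine ⟨fun s => refinedProfile κ b s + w s, fun s => refinedProfileDeriv κ b s + w' s,
    fun s hs => ?_⟩
  have hs0 : 0 < s := by linarith
  obtain ⟨h1, h2, h3, h4⟩ := hw s hs.le
  norm_num only at h3 h4
  have h17 : 17 / s = 1 / s + 16 / s := by ring
  refine ⟨(hasDerivAt_refinedProfile κ b hs0).add h1, ?_, ?_, ?_⟩
  · refine ((hasDerivAt_refinedProfileDeriv κ b hs0).add (h2 hs)).congr_deriv ?_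
    have hb : |refinedProfile κ b s + w s| ≤ 36 := by
      have h16 : 16 / s ≤ 32 := by
        rw [div_le_iff₀ hs0]
        linarith
      linarith [abs_add_le (refinedProfile κ b s) (w s), abs_refinedProfile_le hκ0 hκ1 b hs.le]
    simp only [G, hcl _ hb]
    field_simp
    ring
  · rw [h17, add_sub_right_comm]
    exact (abs_add_le _ _).trans (add_le_add (abs_refinedProfile_sub_cos_le hκ0 hκ1 b hs.le) h3)
  · rw [h17, add_sub_right_comm]
    exact (abs_add_le _ _).trans
      (add_le_add (abs_refinedProfileDeriv_add_sin_le hκ0 hκ1 b hs.le) h4)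

end

/-- Existence at infinity for the model ODE
`g'' + (1 + (β/ρ)g² + 1/(4ρ²))g = 0`: if `δ = (3/8)βa² ≥ 0` is sufficiently small,
there is a solution `g` on `[1,∞)` staying within `C|a|/ρ` of the modified profile
`g₀(ρ) = a cos(ρ + δ log ρ + b)`. -/
theorem ode_existence_at_infinity :
    ∃ ε > (0 : ℝ), ∀ β a b : ℝ,
      (0 : ℝ) ≤ (3 / 8) * β * a ^ 2 → (3 / 8) * β * a ^ 2 ≤ ε →
      ∃ (g : ℝ → ℝ) (C : ℝ),
        (∀ ρ : ℝ, 1 ≤ ρ → DifferentiableAt ℝ g ρ ∧ DifferentiableAt ℝ (deriv g) ρ) ∧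
        (∀ ρ : ℝ, 1 ≤ ρ →
          deriv (deriv g) ρ + (1 + β / ρ * (g ρ) ^ 2 + 1 / (4 * ρ ^ 2)) * g ρ = 0) ∧
        (∀ ρ : ℝ, 1 ≤ ρ →
          |deriv g ρ -
              deriv (fun r => a * Real.cos (r + (3 / 8) * β * a ^ 2 * Real.log r + b)) ρ|
            + |g ρ - a * Real.cos (ρ + (3 / 8) * β * a ^ 2 * Real.log ρ + b)|
            ≤ C * |a| / ρ) := by
  refine ⟨3 / 160000, by norm_num, fun β a b hδ0 hδ => ?_⟩
  obtain ⟨h, h', hh⟩ := exists_normalized_solution (κ := β * a ^ 2) (by linarith)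
    (by linarith) b
  have hg : ∀ s, 1 / 2 < s → HasDerivAt (fun x => a * h x) (a * h' s) s := fun s hs =>
    (hh s hs).1.const_mul a
  have hdg : ∀ s, 1 / 2 < s → deriv (fun x => a * h x) s = a * h' s := fun s hs =>
    (hg s hs).deriv
  have hg' : ∀ s, 1 / 2 < s → HasDerivAt (deriv fun x => a * h x)
      (a * -((1 + β * a ^ 2 / s * h s ^ 2 + 1 / (4 * s ^ 2)) * h s)) s := fun s hs =>
    ((hh s hs).2.1.const_mul a).congr_of_eventuallyEq
      ((eventually_gt_nhds hs).mono hdg)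
  refine ⟨fun s => a * h s, 34, fun ρ hρ => ?_, fun ρ hρ => ?_, fun ρ hρ => ?_⟩
  · exact ⟨(hg ρ (by linarith)).differentiableAt, (hg' ρ (by linarith)).differentiableAt⟩
  · rw [(hg' ρ (by linarith)).deriv]
    ring
  · obtain ⟨-, -, h3, h4⟩ := hh ρ (by linarith)
    have hd : deriv (fun r => a * cos (r + 3 / 8 * β * a ^ 2 * log r + b)) ρ
        = a * (-sin (phase (3 / 8 * (β * a ^ 2)) b ρ) * (1 + 3 / 8 * (β * a ^ 2) / ρ)) := by
      rw [mul_assoc (3 / 8) β]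
      exact ((hasDerivAt_phase (3 / 8 * (β * a ^ 2)) b (by linarith)).cos.const_mul a).deriv
    have hc : cos (ρ + 3 / 8 * β * a ^ 2 * log ρ + b)
        = cos (phase (3 / 8 * (β * a ^ 2)) b ρ) := by
      rw [phase, mul_assoc (3 / 8) β]
    rw [hd, hc, hdg ρ (by linarith), ← mul_sub, ← mul_sub, abs_mul, abs_mul, ← mul_add]
    calc _ ≤ |a| * (17 / ρ + 17 / ρ) := by gcongr
      _ = _ := by ring
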